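/- Let k be a field and let (H, Δ, ε, μ, η, α, β, C) satisfy the left bicoalgebroid axioms. Let M and N be C-bicomodules with left coactions m ↦ m_[-1] ⊗ m_[0], n ↦ n_[-1] ⊗ n_[0] and right coactions m ↦ m_[0] ⊗ m_[1], n ↦ n_[0] ⊗ n_[1]. Suppose an element t = Σ (h ⊗ m) ⊗ (h' ⊗ n) of (H ⊗ M) ⊗ (H ⊗ N) satisfies: (A) Σ h_(1) ⊗ α(h_(2)) ⊗ m ⊗ h' ⊗ n = Σ h ⊗ m_[-1] ⊗ m_[0] ⊗ h' ⊗ n; (B) Σ h_(1) ⊗ β(h_(2)) ⊗ m ⊗ h' ⊗ n = Σ h ⊗ m_[1] ⊗ m_[0] ⊗ h' ⊗ n; (C) Σ h ⊗ m ⊗ h'_(1) ⊗ α(h'_(2)) ⊗ n = Σ h ⊗ m ⊗ h' ⊗ n_[-1] ⊗ n_[0]; (D) Σ h ⊗ m ⊗ h'_(1) ⊗ β(h'_(2)) ⊗ n = Σ h ⊗ m ⊗ h' ⊗ n_[1] ⊗ n_[0]; (E) Σ h_(2) ⊗ m ⊗ β(h_(1)) ⊗ h' ⊗ n = Σ h ⊗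 m ⊗ α(h'_(1)) ⊗ h'_(2) ⊗ n. Write hh' = μ(h ⊗ h') (well defined on the H-legs by (E)). Then: (1) Σ hh' ⊗ m_[0] ⊗ m_[1] ⊗ n = Σ hh' ⊗ m ⊗ n_[-1] ⊗ n_[0]; (2) Σ (hh')_(1) ⊗ α((hh')_(2)) ⊗ m ⊗ n = Σ hh' ⊗ m_[-1] ⊗ m_[0] ⊗ n; (3) Σ (hh')_(1) ⊗ β((hh')_(2)) ⊗ m ⊗ n = Σ hh' ⊗ n_[1] ⊗ m ⊗ n_[0]. -/

import Mathlib

noncomputable section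
open TensorProduct Coalgebra LinearMap

variable (k : Type*) [Field k]
variable (H C : Type*)
  [AddCommGroup H] [Module k H] [Coalgebra k H]
  [AddCommGroup C] [Module k C] [Coalgebra k C]

/-- `λ_L(h) = α(h_(1)) ⊗ h_(2)`. -/
def lamL (α : H →ₗ[k] C) : H →ₗ[k] C ⊗[k] H :=
  TensorProduct.map α LinearMap.id ∘ₗ comul

/-- `ρ_L(h) = h_(2) ⊗ β(h_(1))`. -/
def rhoL (β : H →ₗ[k] C) : H →ₗ[k] H ⊗[k] C :=
  (TensorProduct.comm k C H).toLinearMap ∘ₗ TensorProduct.map β LinearMap.id ∘ₗ comul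

variable {k H C}

/-- the two maps whose equality defines the cotensor product `H ▢_C H`. -/
def cotL (β : H →ₗ[k] C) : H ⊗[k] H →ₗ[k] (H ⊗[k] C) ⊗[k] H :=
  LinearMap.rTensor H (rhoL k H C β)

def cotR (α : H →ₗ[k] C) : H ⊗[k] H →ₗ[k] (H ⊗[k] C) ⊗[k] H :=
  (TensorProduct.assoc k H C H).symm.toLinearMap ∘ₗ LinearMap.lTensor H (lamL k H C α)

/-- membership in `H ▢_C H`: `Σ g_(2) ⊗ β(g_(1)) ⊗ h = Σ g ⊗ α(h_(1)) ⊗ h_(2)`. -/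
def inCot (α β : H →ₗ[k] C) (t : H ⊗[k] H) : Prop :=
  cotL β t = cotR α t

variable (k H C)

/-- A left bicoalgebroid `⟨H, Δ, ε, μ, η, α, β, C⟩` (Brzeziński–Militaru),
with total multiplication `μ : H ⊗ H → H` whose axioms are imposed on the
cotensor product `H ▢_C H`. -/
structure LeftBicoalgebroid where
  α : H →ₗ[k] C
  β : H →ₗ[k] C
  mu : H ⊗[k] H →ₗ[k] H
  eta : C →ₗ[k] H
  /-- α is a coalgebra map -/
  alpha_comul : ∀ h : H, comul (α h) = TensorProduct.map α α (comul h)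
  alpha_counit : ∀ h : H, counit (α h) = (counit h : k)
  /-- β is an anti-coalgebra map -/
  beta_comul : ∀ h : H, comul (β h) =
    (TensorProduct.comm k C C) (TensorProduct.map β β (comul h))
  beta_counit : ∀ h : H, counit (β h) = (counit h : k)
  /-- α and β cocommute -/
  cocommute : ∀ h : H, TensorProduct.map α β (comul h) =
    TensorProduct.map α β ((TensorProduct.comm k H H) (comul h))
  /-- the Takeuchi-type condition: `Σ μ(g ⊗ h_(1)) ⊗ α(h_(2)) = Σ μ(g_(1) ⊗ h) ⊗ β(g_(2))` -/
  mu_takeuchi : ∀ t : H ⊗[k] H, inCot α β t →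
    (TensorProduct.map mu α) ((TensorProduct.assoc k H H H).symm
      ((LinearMap.lTensor H (comul (R := k))) t)) =
    (TensorProduct.map mu β) ((TensorProduct.assoc k H H H).symm
      ((LinearMap.lTensor H (TensorProduct.comm k H H).toLinearMap)
        ((TensorProduct.assoc k H H H)
          ((LinearMap.rTensor H (comul (R := k))) t))))
  /-- comultiplicativity: `Δ(μ(g ⊗ h)) = μ(g_(1) ⊗ h_(1)) ⊗ μ(g_(2) ⊗ h_(2))` -/
  mu_comul : ∀ t : H ⊗[k] H, inCot α β t →
    comul (mu t) = (TensorProduct.map mu mu)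
      ((tensorTensorTensorComm k H H H H)
        ((TensorProduct.map (comul (R := k)) (comul (R := k))) t))
  /-- counitality: `ε(μ(g ⊗ h)) = ε(g) ε(h)` -/
  mu_counit : ∀ t : H ⊗[k] H, inCot α β t →
    (counit (mu t) : k) = (TensorProduct.lid k k)
      ((TensorProduct.map (counit (R := k)) (counit (R := k))) t)
  /-- μ is a left C-comodule map -/
  mu_leftComod : ∀ t : H ⊗[k] H, inCot α β t →
    lamL k H C α (mu t) = (TensorProduct.map α mu)
      ((TensorProduct.assoc k H H H) ((LinearMap.rTensor H (comul (R := k))) t))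
  /-- μ is a right C-comodule map -/
  mu_rightComod : ∀ t : H ⊗[k] H, inCot α β t →
    rhoL k H C β (mu t) = (TensorProduct.map mu β)
      ((TensorProduct.assoc k H H H).symm
        ((LinearMap.lTensor H
          ((TensorProduct.comm k H H).toLinearMap ∘ₗ comul (R := k))) t))
  /-- associativity of μ on `H ▢_C H ▢_C H` -/
  mu_assoc : ∀ u : (H ⊗[k] H) ⊗[k] H,
    (LinearMap.rTensor H (cotL β)) u = (LinearMap.rTensor H (cotR α)) u →
    (LinearMap.lTensor H (cotL β)) ((TensorProduct.assoc k H H H) u) =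
      (LinearMap.lTensor H (cotR α)) ((TensorProduct.assoc k H H H) u) →
    mu ((LinearMap.rTensor H mu) u) =
      mu ((LinearMap.lTensor H mu) ((TensorProduct.assoc k H H H) u))
  /-- η is a left C-comodule map -/
  eta_leftComod : ∀ c : C, lamL k H C α (eta c) =
    (LinearMap.lTensor C eta) (comul c)
  /-- η is a right C-comodule map -/
  eta_rightComod : ∀ c : C, rhoL k H C β (eta c) =
    (LinearMap.rTensor C eta) (comul c)
  /-- unit law: `μ ∘ (η ▢ H) ∘ λ_L = id` -/
  unit_left : ∀ h : H, mu ((LinearMap.rTensor H eta) (lamL k H C α h)) = h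
  /-- unit law: `μ ∘ (H ▢ η) ∘ ρ_L = id` -/
  unit_right : ∀ h : H, mu ((LinearMap.lTensor H eta) (rhoL k H C β h)) = h
  /-- `Δ(η(c)) = η(c)_(1) ⊗ η(α(η(c)_(2)))` -/
  eta_comul_alpha : ∀ c : C, comul (eta c) =
    (LinearMap.lTensor H (eta ∘ₗ α)) (comul (eta c))
  /-- `Δ(η(c)) = η(c)_(1) ⊗ η(β(η(c)_(2)))` -/
  eta_comul_beta : ∀ c : C, comul (eta c) =
    (LinearMap.lTensor H (eta ∘ₗ β)) (comul (eta c))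
  /-- `ε(η(c)) = ε(c)` -/
  eta_counit : ∀ c : C, (counit (eta c) : k) = counit c

/-- A `C`-bicomodule. -/
structure CBicomodule (M : Type*) [AddCommGroup M] [Module k M] where
  lam : M →ₗ[k] C ⊗[k] M
  rho : M →ₗ[k] M ⊗[k] C
  lam_coassoc : ∀ m : M, (TensorProduct.assoc k C C M)
      ((LinearMap.rTensor M (comul (R := k))) (lam m)) = (LinearMap.lTensor C lam) (lam m)
  lam_counit : ∀ m : M, (TensorProduct.lid k M)
      ((LinearMap.rTensor M (counit (R := k) (A := C))) (lam m)) = m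
  rho_coassoc : ∀ m : M, (TensorProduct.assoc k M C C)
      ((LinearMap.rTensor C rho) (rho m)) = (LinearMap.lTensor M (comul (R := k))) (rho m)
  rho_counit : ∀ m : M, (TensorProduct.rid k M)
      ((LinearMap.lTensor M (counit (R := k) (A := C))) (rho m)) = m
  commute : ∀ m : M, (TensorProduct.assoc k C M C)
      ((LinearMap.rTensor C lam) (rho m)) = (LinearMap.lTensor C rho) (lam m)

section CotensorSlices
set_option linter.unusedSectionVars false
variable {k H C}

/-- Tensoring with a vector space preserves equalizers: maps agreeing on the equalizer of `f`
and `g` agree after tensoring on the equalizer of `f ⊗ W` and `g ⊗ W`. -/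
lemma rTensor_apply_eq_of_eqOn_eqLocus {V U P W : Type*}
    [AddCommGroup V] [Module k V] [AddCommGroup U] [Module k U]
    [AddCommGroup P] [Module k P] [AddCommGroup W] [Module k W]
    (f g : V →ₗ[k] U) (p q : V →ₗ[k] P) (h : ∀ x, f x = g x → p x = q x)
    {s : V ⊗[k] W} (hs : f.rTensor W s = g.rTensor W s) :
    p.rTensor W s = q.rTensor W s := by
  have hex := Module.Flat.rTensor_exact (R := k) W (LinearMap.exact_subtype_ker_map (f - g))
  obtain ⟨r, rfl⟩ := (hex s).1 (by rw [LinearMap.rTensor_sub, LinearMap.sub_apply, hs, sub_self])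
  rw [← comp_apply, ← comp_apply, ← rTensor_comp,
    ← rTensor_comp]
  congr 2
  ext ⟨x, hx⟩
  exact h x (sub_eq_zero.1 hx)

lemma lTensor_apply_eq_of_eqOn_eqLocus {V U P W : Type*}
    [AddCommGroup V] [Module k V] [AddCommGroup U] [Module k U]
    [AddCommGroup P] [Module k P] [AddCommGroup W] [Module k W]
    (f g : V →ₗ[k] U) (p q : V →ₗ[k] P) (h : ∀ x, f x = g x → p x = q x)
    {s : W ⊗[k] V} (hs : f.lTensor W s = g.lTensor W s) :
    p.lTensor W s = q.lTensor W s := by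
  have hex := Module.Flat.lTensor_exact (R := k) W (LinearMap.exact_subtype_ker_map (f - g))
  obtain ⟨r, rfl⟩ := (hex s).1 (by rw [LinearMap.lTensor_sub, LinearMap.sub_apply, hs, sub_self])
  rw [← comp_apply, ← comp_apply, ← lTensor_comp,
    ← lTensor_comp]
  congr 2
  ext ⟨x, hx⟩
  exact h x (sub_eq_zero.1 hx)

lemma lTensor_counit_lamL (α : H →ₗ[k] C) (h : H) :
    (counit (R := k)).lTensor C (lamL k H C α h) = α h ⊗ₜ[k] 1 := by
  have e : ∀ z : H ⊗[k] H, (counit (R := k)).lTensor C (TensorProduct.map α LinearMap.id z) =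
      α.rTensor k ((counit (R := k)).lTensor H z) := fun z => by
    induction z <;> simp_all
  simp [lamL, e]

lemma rTensor_counit_rhoL (β : H →ₗ[k] C) (h : H) :
    (counit (R := k)).rTensor C (rhoL k H C β h) = 1 ⊗ₜ[k] β h := by
  have e : ∀ z : H ⊗[k] H, (counit (R := k)).rTensor C
      (TensorProduct.comm k C H (TensorProduct.map β LinearMap.id z)) =
      TensorProduct.comm k C k (β.rTensor k ((counit (R := k)).lTensor H z)) := fun z => by
    induction z <;> simp_all
  simp [rhoL, e]

/-- `Σ g_(2) ⊗ β(g_(1)) ⊗ g_(3)` computed in two ways. -/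
lemma rTensor_rhoL_comul (β : H →ₗ[k] C) (g : H) :
    (rhoL k H C β).rTensor H (comul g) =
      rightComm k H H C ((comul (R := k)).rTensor C (rhoL k H C β g)) := by
  let F : H ⊗[k] (H ⊗[k] H) →ₗ[k] (H ⊗[k] C) ⊗[k] H :=
    ((TensorProduct.comm k C H).toLinearMap ∘ₗ β.rTensor H).rTensor H ∘ₗ
      (TensorProduct.assoc k H H H).symm.toLinearMap
  have e₁ : ∀ z : H ⊗[k] H, (rhoL k H C β).rTensor H z =
      F (TensorProduct.assoc k H H H ((comul (R := k)).rTensor H z)) := fun z => by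
    induction z <;> simp_all [F, rhoL, LinearMap.rTensor]
  have e₂ : ∀ z : H ⊗[k] H, rightComm k H H C ((comul (R := k)).rTensor C
      (TensorProduct.comm k C H (TensorProduct.map β LinearMap.id z))) =
      F ((comul (R := k)).lTensor H z) := fun z => by
    induction z with
    | zero => simp
    | tmul a b =>
      simp only [map_tmul, comm_tmul, rTensor_tmul,
        lTensor_tmul, LinearMap.id_apply]
      induction comul (R := k) b <;> simp_all [F, add_tmul, tmul_add]
    | add x y hx hy => simp only [map_add, hx, hy]
  rw [e₁, Coalgebra.coassoc_apply, ← e₂]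
  rfl

/-- `Σ α(h_(1)) ⊗ h_(2) ⊗ h_(3)` computed in two ways. -/
lemma rTensor_lamL_comul (α : H →ₗ[k] C) (h : H) :
    (lamL k H C α).rTensor H (comul h) =
      (TensorProduct.assoc k C H H).symm ((comul (R := k)).lTensor C (lamL k H C α h)) := by
  let F : H ⊗[k] (H ⊗[k] H) →ₗ[k] (C ⊗[k] H) ⊗[k] H :=
    (α.rTensor H).rTensor H ∘ₗ (TensorProduct.assoc k H H H).symm.toLinearMap
  have e₁ : ∀ z : H ⊗[k] H, (lamL k H C α).rTensor H z =
      F (TensorProduct.assoc k H H H ((comul (R := k)).rTensor H z)) := fun z => by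
    induction z <;> simp_all [F, lamL, LinearMap.rTensor]
  have e₂ : ∀ z : H ⊗[k] H, (TensorProduct.assoc k C H H).symm ((comul (R := k)).lTensor C
      (TensorProduct.map α LinearMap.id z)) = F ((comul (R := k)).lTensor H z) := fun z => by
    induction z with
    | zero => simp
    | tmul a b =>
      simp only [map_tmul, lTensor_tmul, LinearMap.id_apply]
      induction comul (R := k) b <;> simp_all [F, tmul_add]
    | add x y hx hy => simp only [map_add, hx, hy]
  rw [e₁, Coalgebra.coassoc_apply, ← e₂]
  rfl

namespace LeftBicoalgebroid
variable (B : LeftBicoalgebroid k H C)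

/-- The coactions `λ_L` and `ρ_L` make `H` a bicomodule. -/
lemma lTensor_rhoL_lamL (g : H) :
    (rhoL k H C B.β).lTensor C (lamL k H C B.α g) =
      TensorProduct.assoc k C H C ((lamL k H C B.α).rTensor C (rhoL k H C B.β g)) := by
  let F : (C ⊗[k] C) ⊗[k] H →ₗ[k] C ⊗[k] (H ⊗[k] C) :=
    (TensorProduct.comm k C H).toLinearMap.lTensor C ∘ₗ (TensorProduct.assoc k C C H).toLinearMap
  have e₁ : ∀ z : H ⊗[k] H, (rhoL k H C B.β).lTensor C (TensorProduct.map B.α LinearMap.id z) =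
      F (((TensorProduct.map B.α B.β).rTensor H) ((TensorProduct.assoc k H H H).symm
        ((comul (R := k)).lTensor H z))) := fun z => by
    induction z with
    | zero => simp
    | tmul a b =>
      simp only [map_tmul, lTensor_tmul, LinearMap.id_apply, rhoL,
        comp_apply]
      induction comul (R := k) b <;> simp_all [F, tmul_add]
    | add x y hx hy => simp only [map_add, hx, hy]
  have e₂ : ∀ z : H ⊗[k] H, TensorProduct.assoc k C H C ((lamL k H C B.α).rTensor C
      (TensorProduct.comm k C H (TensorProduct.map B.β LinearMap.id z))) =
      F (((TensorProduct.map B.α B.β ∘ₗ (TensorProduct.comm k H H).toLinearMap).rTensor H)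
        ((TensorProduct.assoc k H H H).symm ((comul (R := k)).lTensor H z))) := fun z => by
    induction z with
    | zero => simp
    | tmul a b =>
      simp only [map_tmul, lTensor_tmul, LinearMap.id_apply, lamL,
        comm_tmul, rTensor_tmul, comp_apply]
      induction comul (R := k) b <;> simp_all [F, add_tmul, tmul_add]
    | add x y hx hy => simp only [map_add, hx, hy]
  have e₃ : ∀ z : H ⊗[k] H,
      (TensorProduct.map B.α B.β).rTensor H ((comul (R := k)).rTensor H z) =
      (TensorProduct.map B.α B.β ∘ₗ (TensorProduct.comm k H H).toLinearMap).rTensor H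
        ((comul (R := k)).rTensor H z) := fun z => by
    induction z <;> simp_all [B.cocommute]
  change (rhoL k H C B.β).lTensor C (TensorProduct.map B.α LinearMap.id (comul g)) =
    TensorProduct.assoc k C H C ((lamL k H C B.α).rTensor C
      (TensorProduct.comm k C H (TensorProduct.map B.β LinearMap.id (comul g))))
  rw [e₁, e₂, Coalgebra.coassoc_symm_apply, e₃]

/-- If `Σ g ⊗ h ∈ H ▢ H`, then `Σ α(g_(1)) ⊗ (g_(2) ⊗ h) ∈ C ⊗ (H ▢ H)`. -/
lemma lTensor_cotL_lamL {x : H ⊗[k] H} (hx : inCot B.α B.β x) :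
    (cotL B.β).lTensor C (TensorProduct.assoc k C H H ((lamL k H C B.α).rTensor H x)) =
      (cotR B.α).lTensor C (TensorProduct.assoc k C H H ((lamL k H C B.α).rTensor H x)) := by
  let F : (H ⊗[k] C) ⊗[k] H →ₗ[k] C ⊗[k] ((H ⊗[k] C) ⊗[k] H) :=
    (TensorProduct.assoc k C (H ⊗[k] C) H).toLinearMap ∘ₗ
      ((TensorProduct.assoc k C H C).toLinearMap ∘ₗ (lamL k H C B.α).rTensor C).rTensor H
  let K : (C ⊗[k] H) ⊗[k] (C ⊗[k] H) →ₗ[k] C ⊗[k] ((H ⊗[k] C) ⊗[k] H) :=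
    (TensorProduct.assoc k H C H).symm.toLinearMap.lTensor C ∘ₗ
      (TensorProduct.assoc k C H (C ⊗[k] H)).toLinearMap
  have e₁ : ∀ x, (cotL B.β).lTensor C (TensorProduct.assoc k C H H
      ((lamL k H C B.α).rTensor H x)) = F (cotL B.β x) := fun x => by
    induction x with
    | zero => simp
    | tmul g h =>
      have : ∀ z : C ⊗[k] H, (cotL B.β).lTensor C (TensorProduct.assoc k C H H (z ⊗ₜ h)) =
          TensorProduct.assoc k C (H ⊗[k] C) H ((rhoL k H C B.β).lTensor C z ⊗ₜ h) := fun z => by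
        induction z <;> simp_all [cotL, add_tmul]
      rw [rTensor_tmul, this, B.lTensor_rhoL_lamL]
      simp [F, cotL]
    | add x y hx hy => simp only [map_add, hx, hy]
  have e₂ : ∀ x, (cotR B.α).lTensor C (TensorProduct.assoc k C H H
      ((lamL k H C B.α).rTensor H x)) = F (cotR B.α x) := fun x => by
    induction x with
    | zero => simp
    | tmul g h =>
      have hz : ∀ z : C ⊗[k] H, (cotR B.α).lTensor C (TensorProduct.assoc k C H H (z ⊗ₜ h)) =
          K (z ⊗ₜ lamL k H C B.α h) := fun z => by
        induction z <;> simp_all [K, cotR, add_tmul]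
      have hw : ∀ w : C ⊗[k] H, F ((TensorProduct.assoc k H C H).symm (g ⊗ₜ w)) =
          K (lamL k H C B.α g ⊗ₜ w) := fun w => by
        induction w with
        | zero => simp
        | tmul c d =>
          simp only [F, assoc_symm_tmul, comp_apply,
            rTensor_tmul, LinearEquiv.coe_coe]
          induction lamL k H C B.α g <;> simp_all [K, add_tmul]
        | add x y hx hy => simp only [map_add, tmul_add, hx, hy]
      rw [rTensor_tmul, hz, ← hw]
      simp [cotR]
    | add x y hx hy => simp only [map_add, hx, hy]
  rw [e₁, e₂, show cotL B.β x = cotR B.α x from hx]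

/-- If `Σ g ⊗ h ∈ H ▢ H`, then `Σ (g ⊗ h_(2)) ⊗ β(h_(1)) ∈ (H ▢ H) ⊗ C`. -/
lemma rTensor_cotL_rhoL {x : H ⊗[k] H} (hx : inCot B.α B.β x) :
    (cotL B.β).rTensor C ((TensorProduct.assoc k H H C).symm ((rhoL k H C B.β).lTensor H x)) =
      (cotR B.α).rTensor C
        ((TensorProduct.assoc k H H C).symm ((rhoL k H C B.β).lTensor H x)) := by
  let F : (H ⊗[k] C) ⊗[k] H →ₗ[k] ((H ⊗[k] C) ⊗[k] H) ⊗[k] C :=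
    (TensorProduct.assoc k (H ⊗[k] C) H C).symm.toLinearMap ∘ₗ
      (rhoL k H C B.β).lTensor (H ⊗[k] C)
  have e₁ : ∀ x, (cotL B.β).rTensor C ((TensorProduct.assoc k H H C).symm
      ((rhoL k H C B.β).lTensor H x)) = F (cotL B.β x) := fun x => by
    induction x with
    | zero => simp
    | tmul g h =>
      simp only [F, cotL, comp_apply, rTensor_tmul, lTensor_tmul,
        LinearEquiv.coe_coe]
      induction rhoL k H C B.β h <;> simp_all [tmul_add]
    | add x y hx hy => simp only [map_add, hx, hy]
  have e₂ : ∀ x, (cotR B.α).rTensor C ((TensorProduct.assoc k H H C).symm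
      ((rhoL k H C B.β).lTensor H x)) = F (cotR B.α x) := fun x => by
    induction x with
    | zero => simp
    | tmul g h =>
      let K : C ⊗[k] (H ⊗[k] C) →ₗ[k] ((H ⊗[k] C) ⊗[k] H) ⊗[k] C :=
        (TensorProduct.assoc k (H ⊗[k] C) H C).symm.toLinearMap ∘ₗ
          (TensorProduct.assoc k H C (H ⊗[k] C)).symm.toLinearMap ∘ₗ
            TensorProduct.mk k H (C ⊗[k] (H ⊗[k] C)) g
      have hz : ∀ z : H ⊗[k] C, (cotR B.α).rTensor C ((TensorProduct.assoc k H H C).symm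
          (g ⊗ₜ z)) = K (TensorProduct.assoc k C H C ((lamL k H C B.α).rTensor C z)) := fun z => by
        induction z with
        | zero => simp
        | tmul a b =>
          simp only [assoc_symm_tmul, rTensor_tmul, cotR,
            lTensor_tmul, comp_apply]
          induction lamL k H C B.α a <;> simp_all [K, add_tmul, tmul_add]
        | add x y hx hy => simp only [map_add, tmul_add, hx, hy]
      have hw : ∀ w : C ⊗[k] H, F ((TensorProduct.assoc k H C H).symm (g ⊗ₜ w)) =
          K ((rhoL k H C B.β).lTensor C w) := fun w => by
        induction w <;> simp_all [F, K, tmul_add]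
      rw [lTensor_tmul, hz, ← B.lTensor_rhoL_lamL, ← hw]
      simp [cotR]
    | add x y hx hy => simp only [map_add, hx, hy]
  rw [e₁, e₂, show cotL B.β x = cotR B.α x from hx]

/-- `α(μ(g ⊗ h)) = α(g) ε(h)` on `H ▢ H`. -/
lemma alpha_mu {x : H ⊗[k] H} (hx : inCot B.α B.β x) :
    B.α (B.mu x) = TensorProduct.rid k C (TensorProduct.map B.α (counit (R := k)) x) := by
  have h₁ := lTensor_counit_lamL B.α (B.mu x)
  have e : ∀ x : H ⊗[k] H, TensorProduct.map B.α B.mu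
      (TensorProduct.assoc k H H H ((comul (R := k)).rTensor H x)) =
      B.mu.lTensor C (TensorProduct.assoc k C H H ((lamL k H C B.α).rTensor H x)) := fun x => by
    induction x with
    | zero => simp
    | tmul g h =>
      simp only [rTensor_tmul, lamL, comp_apply]
      induction comul (R := k) g <;> simp_all [add_tmul]
    | add x y hx hy => simp only [map_add, hx, hy]
  have e' : ∀ x : H ⊗[k] H, ((TensorProduct.lid k k).toLinearMap ∘ₗ
      TensorProduct.map (counit (R := k)) (counit (R := k))).lTensor C
        (TensorProduct.assoc k C H H ((lamL k H C B.α).rTensor H x)) =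
      TensorProduct.map B.α (counit (R := k)) x := fun x => by
    induction x with
    | zero => simp
    | tmul g h =>
      have hz : ∀ z : C ⊗[k] H, ((TensorProduct.lid k k).toLinearMap ∘ₗ
          TensorProduct.map (counit (R := k)) (counit (R := k))).lTensor C
            (TensorProduct.assoc k C H H (z ⊗ₜ h)) =
          (counit (R := k) h) • (counit (R := k)).lTensor C z := fun z => by
        induction z <;> simp_all [mul_comm, ← tmul_smul, add_tmul, smul_add]
      rw [rTensor_tmul, hz, lTensor_counit_lamL]
      simp [← tmul_smul]
    | add x y hx hy => simp only [map_add, hx, hy]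
  have h₂ := lTensor_apply_eq_of_eqOn_eqLocus (cotL B.β) (cotR B.α) (counit (R := k) ∘ₗ B.mu)
    ((TensorProduct.lid k k).toLinearMap ∘ₗ
      TensorProduct.map (counit (R := k)) (counit (R := k))) B.mu_counit (B.lTensor_cotL_lamL hx)
  rw [B.mu_leftComod x hx, e, ← comp_apply, ← lTensor_comp, h₂, e'] at h₁
  simp [h₁]

/-- `β(μ(g ⊗ h)) = ε(g) β(h)` on `H ▢ H`. -/
lemma beta_mu {x : H ⊗[k] H} (hx : inCot B.α B.β x) :
    B.β (B.mu x) = TensorProduct.lid k C (TensorProduct.map (counit (R := k)) B.β x) := by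
  have h₁ := rTensor_counit_rhoL B.β (B.mu x)
  have e : ∀ x : H ⊗[k] H, TensorProduct.map B.mu B.β ((TensorProduct.assoc k H H H).symm
      (((TensorProduct.comm k H H).toLinearMap ∘ₗ comul (R := k)).lTensor H x)) =
      B.mu.rTensor C ((TensorProduct.assoc k H H C).symm
        ((rhoL k H C B.β).lTensor H x)) := fun x => by
    induction x with
    | zero => simp
    | tmul g h =>
      simp only [lTensor_tmul, rhoL, comp_apply]
      induction comul (R := k) h <;> simp_all [tmul_add]
    | add x y hx hy => simp only [map_add, hx, hy]
  have e' : ∀ x : H ⊗[k] H, ((TensorProduct.lid k k).toLinearMap ∘ₗ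
      TensorProduct.map (counit (R := k)) (counit (R := k))).rTensor C
        ((TensorProduct.assoc k H H C).symm ((rhoL k H C B.β).lTensor H x)) =
      TensorProduct.map (counit (R := k)) B.β x := fun x => by
    induction x with
    | zero => simp
    | tmul g h =>
      have hz : ∀ z : H ⊗[k] C, ((TensorProduct.lid k k).toLinearMap ∘ₗ
          TensorProduct.map (counit (R := k)) (counit (R := k))).rTensor C
            ((TensorProduct.assoc k H H C).symm (g ⊗ₜ z)) =
          (counit (R := k) g) • (counit (R := k)).rTensor C z := fun z => by
        induction z <;> simp_all [TensorProduct.smul_tmul', tmul_add, smul_add]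
      rw [lTensor_tmul, hz, rTensor_counit_rhoL]
      simp [TensorProduct.smul_tmul']
    | add x y hx hy => simp only [map_add, hx, hy]
  have h₂ := rTensor_apply_eq_of_eqOn_eqLocus (cotL B.β) (cotR B.α) (counit (R := k) ∘ₗ B.mu)
    ((TensorProduct.lid k k).toLinearMap ∘ₗ
      TensorProduct.map (counit (R := k)) (counit (R := k))) B.mu_counit (B.rTensor_cotL_rhoL hx)
  rw [B.mu_rightComod x hx, e, ← comp_apply, ← rTensor_comp, h₂, e'] at h₁
  simp [h₁]

/-- `Σ g ⊗ h ↦ Σ (g_(1) ⊗ h_(1)) ⊗ (g_(2) ⊗ h_(2))`. -/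
def comulPair : H ⊗[k] H →ₗ[k] (H ⊗[k] H) ⊗[k] (H ⊗[k] H) :=
  (tensorTensorTensorComm k H H H H).toLinearMap ∘ₗ
    TensorProduct.map (comul (R := k)) (comul (R := k))

lemma comulPair_tmul (g h : H) : comulPair (k := k) (g ⊗ₜ h) =
    tensorTensorTensorComm k H H H H (comul (R := k) g ⊗ₜ comul (R := k) h) := rfl

/-- If `Σ g ⊗ h ∈ H ▢ H`, then `Σ (g_(1) ⊗ h_(1)) ⊗ (g_(2) ⊗ h_(2)) ∈ (H ▢ H) ⊗ (H ⊗ H)`. -/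
lemma rTensor_cotL_comulPair {x : H ⊗[k] H} (hx : inCot B.α B.β x) :
    (cotL B.β).rTensor (H ⊗[k] H) (comulPair x) =
      (cotR B.α).rTensor (H ⊗[k] H) (comulPair x) := by
  let F : (H ⊗[k] C) ⊗[k] H →ₗ[k] ((H ⊗[k] C) ⊗[k] H) ⊗[k] (H ⊗[k] H) :=
    (tensorTensorTensorComm k (H ⊗[k] C) H H H).toLinearMap ∘ₗ
      TensorProduct.map ((rightComm k H H C).toLinearMap ∘ₗ
        (comul (R := k)).rTensor C) (comul (R := k))
  have e₁ : ∀ x, (cotL B.β).rTensor (H ⊗[k] H) (comulPair x) = F (cotL B.β x) := fun x => by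
    induction x with
    | zero => simp
    | tmul g h =>
      have hz : ∀ z w : H ⊗[k] H, (cotL B.β).rTensor (H ⊗[k] H)
          (tensorTensorTensorComm k H H H H (z ⊗ₜ w)) =
          tensorTensorTensorComm k (H ⊗[k] C) H H H
            ((rhoL k H C B.β).rTensor H z ⊗ₜ w) := fun z w => by
        induction z with
        | zero => simp
        | tmul a b =>
          induction w <;> simp_all [cotL, tmul_add]
        | add x y hx hy => simp only [map_add, add_tmul, hx, hy]
      have hc := hz (comul g) (comul h)
      rw [rTensor_rhoL_comul] at hc
      simpa [comulPair, F, cotL] using hc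
    | add x y hx hy => simp only [map_add, hx, hy]
  have e₂ : ∀ x, (cotR B.α).rTensor (H ⊗[k] H) (comulPair x) = F (cotR B.α x) := fun x => by
    induction x with
    | zero => simp
    | tmul g h =>
      let K : (H ⊗[k] H) ⊗[k] ((C ⊗[k] H) ⊗[k] H) →ₗ[k]
          ((H ⊗[k] C) ⊗[k] H) ⊗[k] (H ⊗[k] H) :=
        (TensorProduct.assoc k H C H).symm.toLinearMap.rTensor (H ⊗[k] H) ∘ₗ
          (tensorTensorTensorComm k H H (C ⊗[k] H) H).toLinearMap
      have hz : ∀ z w : H ⊗[k] H, (cotR B.α).rTensor (H ⊗[k] H)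
          (tensorTensorTensorComm k H H H H (z ⊗ₜ w)) =
          K (z ⊗ₜ (lamL k H C B.α).rTensor H w) := fun z w => by
        induction z with
        | zero => simp
        | tmul a b =>
          induction w <;> simp_all [cotR, K, tmul_add]
        | add x y hx hy => simp only [map_add, add_tmul, hx, hy]
      have hw : ∀ w : C ⊗[k] H, F ((TensorProduct.assoc k H C H).symm (g ⊗ₜ w)) =
          K (comul (R := k) g ⊗ₜ (TensorProduct.assoc k C H H).symm
            ((comul (R := k)).lTensor C w)) := fun w => by
        induction w with
        | zero => simp
        | tmul c d =>
          simp only [F, assoc_symm_tmul, comp_apply,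
            lTensor_tmul, rTensor_tmul, LinearEquiv.coe_coe,
            map_tmul]
          generalize comul (R := k) d = w
          induction comul (R := k) g with
          | zero => simp
          | tmul a b =>
            induction w <;> simp_all [K, tmul_add]
          | add x y hx hy => simp only [map_add, add_tmul, hx, hy]
        | add x y hx hy => simp only [map_add, tmul_add, hx, hy]
      have hc := hz (comul g) (comul h)
      rw [rTensor_lamL_comul, ← hw] at hc
      simpa [comulPair, cotR] using hc
    | add x y hx hy => simp only [map_add, hx, hy]
  rw [e₁, e₂, show cotL B.β x = cotR B.α x from hx]

/-- If `Σ g ⊗ h ∈ H ▢ H`, then `Σ μ(g_(1) ⊗ h_(1)) ⊗ (g_(2) ⊗ h_(2)) ∈ H ⊗ (H ▢ H)`. -/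
lemma lTensor_cotL_mu_comulPair {x : H ⊗[k] H} (hx : inCot B.α B.β x) :
    (cotL B.β).lTensor H (B.mu.rTensor (H ⊗[k] H) (comulPair x)) =
      (cotR B.α).lTensor H (B.mu.rTensor (H ⊗[k] H) (comulPair x)) := by
  let S : (H ⊗[k] C) ⊗[k] (H ⊗[k] H) →ₗ[k] H ⊗[k] ((H ⊗[k] C) ⊗[k] H) :=
    ((TensorProduct.assoc k H C H).symm.toLinearMap ∘ₗ
        (leftComm k C H H).toLinearMap).lTensor H ∘ₗ
      (TensorProduct.assoc k H C (H ⊗[k] H)).toLinearMap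
  let TL : H ⊗[k] H →ₗ[k] H ⊗[k] C := TensorProduct.map B.mu B.β ∘ₗ
    (TensorProduct.assoc k H H H).symm.toLinearMap ∘ₗ
      (TensorProduct.comm k H H).toLinearMap.lTensor H ∘ₗ
        (TensorProduct.assoc k H H H).toLinearMap ∘ₗ (comul (R := k)).rTensor H
  let TR : H ⊗[k] H →ₗ[k] H ⊗[k] C := TensorProduct.map B.mu B.α ∘ₗ
    (TensorProduct.assoc k H H H).symm.toLinearMap ∘ₗ (comul (R := k)).lTensor H
  have hT : TR.rTensor (H ⊗[k] H) (comulPair x) = TL.rTensor (H ⊗[k] H) (comulPair x) :=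
    rTensor_apply_eq_of_eqOn_eqLocus (cotL B.β) (cotR B.α) TR TL B.mu_takeuchi
      (B.rTensor_cotL_comulPair hx)
  have eL : ∀ x, S (TL.rTensor (H ⊗[k] H) (comulPair x)) =
      (cotL B.β).lTensor H (B.mu.rTensor (H ⊗[k] H) (comulPair x)) := fun x => by
    let K : (H ⊗[k] (H ⊗[k] H)) ⊗[k] (H ⊗[k] H) →ₗ[k] H ⊗[k] ((H ⊗[k] C) ⊗[k] H) :=
      TensorProduct.map B.mu (((TensorProduct.comm k C H).toLinearMap ∘ₗ
        TensorProduct.map B.β LinearMap.id).rTensor H) ∘ₗ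
          (tensorTensorTensorComm k H (H ⊗[k] H) H H).toLinearMap
    have h₁ : ∀ z w : H ⊗[k] H, S (TL.rTensor (H ⊗[k] H)
        (tensorTensorTensorComm k H H H H (z ⊗ₜ w))) =
        K (TensorProduct.assoc k H H H ((comul (R := k)).rTensor H z) ⊗ₜ w) := fun z w => by
      induction z with
      | zero => simp
      | tmul a b =>
        induction w with
        | zero => simp
        | tmul c d =>
          simp only [tensorTensorTensorComm_tmul, rTensor_tmul, TL, comp_apply]
          induction comul (R := k) a <;> simp_all [S, K, add_tmul]
        | add x y hx hy => simp only [map_add, tmul_add, hx, hy]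
      | add x y hx hy => simp only [map_add, add_tmul, hx, hy]
    have h₂ : ∀ z w : H ⊗[k] H, (cotL B.β).lTensor H (B.mu.rTensor (H ⊗[k] H)
        (tensorTensorTensorComm k H H H H (z ⊗ₜ w))) =
        K ((comul (R := k)).lTensor H z ⊗ₜ w) := fun z w => by
      induction z with
      | zero => simp
      | tmul a b =>
        induction w <;> simp_all [cotL, rhoL, K, tmul_add]
      | add x y hx hy => simp only [map_add, add_tmul, hx, hy]
    induction x with
    | zero => simp
    | tmul g h =>
      rw [comulPair_tmul, h₁, h₂, Coalgebra.coassoc_apply]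
    | add x y hx hy => simp only [map_add, hx, hy]
  have eR : ∀ x, S (TR.rTensor (H ⊗[k] H) (comulPair x)) =
      (cotR B.α).lTensor H (B.mu.rTensor (H ⊗[k] H) (comulPair x)) := fun x => by
    let K : (H ⊗[k] H) ⊗[k] (H ⊗[k] (H ⊗[k] H)) →ₗ[k] H ⊗[k] ((H ⊗[k] C) ⊗[k] H) :=
      TensorProduct.map B.mu ((TensorProduct.assoc k H C H).symm.toLinearMap ∘ₗ
        (TensorProduct.map B.α LinearMap.id).lTensor H) ∘ₗ
          (tensorTensorTensorComm k H H H (H ⊗[k] H)).toLinearMap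
    have h₁ : ∀ z w : H ⊗[k] H, S (TR.rTensor (H ⊗[k] H)
        (tensorTensorTensorComm k H H H H (z ⊗ₜ w))) =
        K (z ⊗ₜ TensorProduct.assoc k H H H ((comul (R := k)).rTensor H w)) := fun z w => by
      induction z with
      | zero => simp
      | tmul a b =>
        induction w with
        | zero => simp
        | tmul c d =>
          simp only [tensorTensorTensorComm_tmul, rTensor_tmul, TR,
            lTensor_tmul, comp_apply]
          induction comul (R := k) c <;> simp_all [S, K, add_tmul, tmul_add]
        | add x y hx hy => simp only [map_add, tmul_add, hx, hy]
      | add x y hx hy => simp only [map_add, add_tmul, hx, hy]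
    have h₂ : ∀ z w : H ⊗[k] H, (cotR B.α).lTensor H (B.mu.rTensor (H ⊗[k] H)
        (tensorTensorTensorComm k H H H H (z ⊗ₜ w))) =
        K (z ⊗ₜ (comul (R := k)).lTensor H w) := fun z w => by
      induction z with
      | zero => simp
      | tmul a b =>
        induction w <;> simp_all [cotR, lamL, K, tmul_add]
      | add x y hx hy => simp only [map_add, add_tmul, hx, hy]
    induction x with
    | zero => simp
    | tmul g h =>
      rw [comulPair_tmul, h₁, h₂, Coalgebra.coassoc_apply]
    | add x y hx hy => simp only [map_add, hx, hy]
  rw [← eL, ← eR, hT]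

/-- `Σ (gh)_(1) ⊗ α((gh)_(2)) = Σ g_(1)h ⊗ α(g_(2))` on `H ▢ H`. -/
lemma lTensor_alpha_comul_mu {x : H ⊗[k] H} (hx : inCot B.α B.β x) :
    TensorProduct.map LinearMap.id B.α (comul (R := k) (B.mu x)) =
      B.mu.rTensor C (rightComm k H C H
        ((TensorProduct.map LinearMap.id B.α ∘ₗ comul (R := k)).rTensor H x)) := by
  have h₁ := lTensor_apply_eq_of_eqOn_eqLocus (cotL B.β) (cotR B.α) (B.α ∘ₗ B.mu)
    ((TensorProduct.rid k C).toLinearMap ∘ₗ TensorProduct.map B.α (counit (R := k)))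
    (fun _ => B.alpha_mu) (B.lTensor_cotL_mu_comulPair hx)
  have e₁ : ∀ y : (H ⊗[k] H) ⊗[k] (H ⊗[k] H),
      TensorProduct.map LinearMap.id B.α (TensorProduct.map B.mu B.mu y) =
        (B.α ∘ₗ B.mu).lTensor H (B.mu.rTensor (H ⊗[k] H) y) := fun y => by
    induction y <;> simp_all
  have e₂ : ∀ x : H ⊗[k] H, ((TensorProduct.rid k C).toLinearMap ∘ₗ
      TensorProduct.map B.α (counit (R := k))).lTensor H
        (B.mu.rTensor (H ⊗[k] H) (comulPair x)) =
      B.mu.rTensor C (rightComm k H C H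
        ((TensorProduct.map LinearMap.id B.α ∘ₗ comul (R := k)).rTensor H x)) := fun x => by
    induction x with
    | zero => simp
    | tmul g h =>
      have hz : ∀ z w : H ⊗[k] H, ((TensorProduct.rid k C).toLinearMap ∘ₗ
          TensorProduct.map B.α (counit (R := k))).lTensor H
            (B.mu.rTensor (H ⊗[k] H) (tensorTensorTensorComm k H H H H (z ⊗ₜ w))) =
          B.mu.rTensor C (rightComm k H C H
            (TensorProduct.map LinearMap.id B.α z ⊗ₜ
              TensorProduct.rid k H ((counit (R := k)).lTensor H w))) := fun z w => by
        induction z with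
        | zero => simp
        | tmul a b =>
          induction w <;> simp_all [tmul_add]
        | add x y hx hy => simp only [map_add, add_tmul, hx, hy]
      rw [comulPair_tmul, hz, Coalgebra.lTensor_counit_comul]
      simp
    | add x y hx hy => simp only [map_add, hx, hy]
  rw [B.mu_comul x hx, e₁, ← e₂, ← h₁]
  rfl

/-- `Σ (gh)_(1) ⊗ β((gh)_(2)) = Σ gh_(1) ⊗ β(h_(2))` on `H ▢ H`. -/
lemma lTensor_beta_comul_mu {x : H ⊗[k] H} (hx : inCot B.α B.β x) :
    TensorProduct.map LinearMap.id B.β (comul (R := k) (B.mu x)) =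
      B.mu.rTensor C ((TensorProduct.assoc k H H C).symm
        ((TensorProduct.map LinearMap.id B.β ∘ₗ comul (R := k)).lTensor H x)) := by
  have h₁ := lTensor_apply_eq_of_eqOn_eqLocus (cotL B.β) (cotR B.α) (B.β ∘ₗ B.mu)
    ((TensorProduct.lid k C).toLinearMap ∘ₗ TensorProduct.map (counit (R := k)) B.β)
    (fun _ => B.beta_mu) (B.lTensor_cotL_mu_comulPair hx)
  have e₁ : ∀ y : (H ⊗[k] H) ⊗[k] (H ⊗[k] H),
      TensorProduct.map LinearMap.id B.β (TensorProduct.map B.mu B.mu y) =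
        (B.β ∘ₗ B.mu).lTensor H (B.mu.rTensor (H ⊗[k] H) y) := fun y => by
    induction y <;> simp_all
  have e₂ : ∀ x : H ⊗[k] H, ((TensorProduct.lid k C).toLinearMap ∘ₗ
      TensorProduct.map (counit (R := k)) B.β).lTensor H
        (B.mu.rTensor (H ⊗[k] H) (comulPair x)) =
      B.mu.rTensor C ((TensorProduct.assoc k H H C).symm
        ((TensorProduct.map LinearMap.id B.β ∘ₗ comul (R := k)).lTensor H x)) := fun x => by
    induction x with
    | zero => simp
    | tmul g h =>
      have hz : ∀ z w : H ⊗[k] H, ((TensorProduct.lid k C).toLinearMap ∘ₗ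
          TensorProduct.map (counit (R := k)) B.β).lTensor H
            (B.mu.rTensor (H ⊗[k] H) (tensorTensorTensorComm k H H H H (z ⊗ₜ w))) =
          B.mu.rTensor C ((TensorProduct.assoc k H H C).symm
            (TensorProduct.rid k H ((counit (R := k)).lTensor H z) ⊗ₜ
              TensorProduct.map LinearMap.id B.β w)) := fun z w => by
        induction z with
        | zero => simp
        | tmul a b =>
          induction w <;> simp_all [← TensorProduct.smul_tmul', tmul_add]
        | add x y hx hy => simp only [map_add, add_tmul, hx, hy]
      rw [comulPair_tmul, hz, Coalgebra.lTensor_counit_comul]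
      simp
    | add x y hx hy => simp only [map_add, hx, hy]
  rw [B.mu_comul x hx, e₁, ← e₂, ← h₁]
  rfl

/-- The Takeuchi condition in the form `Σ g_(1)h ⊗ β(g_(2)) = Σ gh_(1) ⊗ α(h_(2))`. -/
lemma mu_beta_eq_mu_alpha {x : H ⊗[k] H} (hx : inCot B.α B.β x) :
    B.mu.rTensor C (rightComm k H C H
        ((TensorProduct.map LinearMap.id B.β ∘ₗ comul (R := k)).rTensor H x)) =
      B.mu.rTensor C ((TensorProduct.assoc k H H C).symm
        ((TensorProduct.map LinearMap.id B.α ∘ₗ comul (R := k)).lTensor H x)) := by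
  have eL : ∀ x : H ⊗[k] H, B.mu.rTensor C (rightComm k H C H
      ((TensorProduct.map LinearMap.id B.β ∘ₗ comul (R := k)).rTensor H x)) =
      TensorProduct.map B.mu B.β ((TensorProduct.assoc k H H H).symm
        ((TensorProduct.comm k H H).toLinearMap.lTensor H (TensorProduct.assoc k H H H
          ((comul (R := k)).rTensor H x)))) := fun x => by
    induction x with
    | zero => simp
    | tmul g h =>
      simp only [rTensor_tmul, comp_apply]
      induction comul (R := k) g <;> simp_all [add_tmul]
    | add x y hx hy => simp only [map_add, hx, hy]
  have eR : ∀ x : H ⊗[k] H, B.mu.rTensor C ((TensorProduct.assoc k H H C).symm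
      ((TensorProduct.map LinearMap.id B.α ∘ₗ comul (R := k)).lTensor H x)) =
      TensorProduct.map B.mu B.α ((TensorProduct.assoc k H H H).symm
        ((comul (R := k)).lTensor H x)) := fun x => by
    induction x with
    | zero => simp
    | tmul g h =>
      simp only [lTensor_tmul, comp_apply]
      induction comul (R := k) h <;> simp_all [tmul_add]
    | add x y hx hy => simp only [map_add, hx, hy]
  rw [eL, eR, B.mu_takeuchi x hx]

end LeftBicoalgebroid

section Reshuffle
variable {M N : Type*} [AddCommGroup M] [Module k M] [AddCommGroup N] [Module k N]

/-- `((g ⊗ c) ⊗ m) ⊗ (h ⊗ n) ↦ (gh ⊗ c) ⊗ (m ⊗ n)`. -/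
def mulOverLeft (mu : H ⊗[k] H →ₗ[k] H) :
    ((H ⊗[k] C) ⊗[k] M) ⊗[k] (H ⊗[k] N) →ₗ[k] (H ⊗[k] C) ⊗[k] (M ⊗[k] N) :=
  (mu.rTensor C ∘ₗ (rightComm k H C H).toLinearMap).rTensor (M ⊗[k] N) ∘ₗ
    (tensorTensorTensorComm k (H ⊗[k] C) M H N).toLinearMap

/-- `(g ⊗ m) ⊗ ((h ⊗ c) ⊗ n) ↦ (gh ⊗ c) ⊗ (m ⊗ n)`. -/
def mulOverRight (mu : H ⊗[k] H →ₗ[k] H) :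
    (H ⊗[k] M) ⊗[k] ((H ⊗[k] C) ⊗[k] N) →ₗ[k] (H ⊗[k] C) ⊗[k] (M ⊗[k] N) :=
  (mu.rTensor C ∘ₗ (TensorProduct.assoc k H H C).symm.toLinearMap).rTensor (M ⊗[k] N) ∘ₗ
    (tensorTensorTensorComm k H M (H ⊗[k] C) N).toLinearMap

lemma mulOverLeft_rTensor (mu : H ⊗[k] H →ₗ[k] H) (f : H →ₗ[k] H ⊗[k] C)
    (t : (H ⊗[k] M) ⊗[k] (H ⊗[k] N)) :
    mulOverLeft mu ((f.rTensor M).rTensor (H ⊗[k] N) t) =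
      (mu.rTensor C ∘ₗ (rightComm k H C H).toLinearMap ∘ₗ
        f.rTensor H).rTensor (M ⊗[k] N) (tensorTensorTensorComm k H M H N t) := by
  have : mulOverLeft mu ∘ₗ (f.rTensor M).rTensor (H ⊗[k] N) =
      (mu.rTensor C ∘ₗ (rightComm k H C H).toLinearMap ∘ₗ
        f.rTensor H).rTensor (M ⊗[k] N) ∘ₗ (tensorTensorTensorComm k H M H N).toLinearMap := by
    ext; simp [mulOverLeft]
  exact LinearMap.congr_fun this t

lemma mulOverRight_lTensor (mu : H ⊗[k] H →ₗ[k] H) (f : H →ₗ[k] H ⊗[k] C)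
    (t : (H ⊗[k] M) ⊗[k] (H ⊗[k] N)) :
    mulOverRight mu ((f.rTensor N).lTensor (H ⊗[k] M) t) =
      (mu.rTensor C ∘ₗ (TensorProduct.assoc k H H C).symm.toLinearMap ∘ₗ
        f.lTensor H).rTensor (M ⊗[k] N) (tensorTensorTensorComm k H M H N t) := by
  have : mulOverRight mu ∘ₗ (f.rTensor N).lTensor (H ⊗[k] M) =
      (mu.rTensor C ∘ₗ (TensorProduct.assoc k H H C).symm.toLinearMap ∘ₗ
        f.lTensor H).rTensor (M ⊗[k] N) ∘ₗ (tensorTensorTensorComm k H M H N).toLinearMap := by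
    ext; simp [mulOverRight]
  exact LinearMap.congr_fun this t

lemma mulOverLeft_coaction (mu : H ⊗[k] H →ₗ[k] H) (f : M →ₗ[k] C ⊗[k] M)
    (t : (H ⊗[k] M) ⊗[k] (H ⊗[k] N)) :
    mulOverLeft mu (((TensorProduct.assoc k H C M).symm.toLinearMap ∘ₗ
        f.lTensor H).rTensor (H ⊗[k] N) t) =
      (TensorProduct.assoc k H C (M ⊗[k] N)).symm
        (((TensorProduct.assoc k C M N).toLinearMap ∘ₗ f.rTensor N).lTensor H
          (TensorProduct.map mu LinearMap.id (tensorTensorTensorComm k H M H N t))) := by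
  have : mulOverLeft mu ∘ₗ ((TensorProduct.assoc k H C M).symm.toLinearMap ∘ₗ
        f.lTensor H).rTensor (H ⊗[k] N) =
      (TensorProduct.assoc k H C (M ⊗[k] N)).symm.toLinearMap ∘ₗ
        ((TensorProduct.assoc k C M N).toLinearMap ∘ₗ f.rTensor N).lTensor H ∘ₗ
          TensorProduct.map mu LinearMap.id ∘ₗ
            (tensorTensorTensorComm k H M H N).toLinearMap := by
    ext h m h' n
    simp only [TensorProduct.AlgebraTensorModule.curry_apply, LinearMap.restrictScalars_self,
      TensorProduct.curry_apply, comp_apply, rTensor_tmul,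
      lTensor_tmul, LinearEquiv.coe_coe, tensorTensorTensorComm_tmul,
      map_tmul, LinearMap.id_apply]
    induction f m <;> simp_all [mulOverLeft, add_tmul, tmul_add]
  exact LinearMap.congr_fun this t

lemma mulOverRight_coaction (mu : H ⊗[k] H →ₗ[k] H) (f : N →ₗ[k] C ⊗[k] N)
    (t : (H ⊗[k] M) ⊗[k] (H ⊗[k] N)) :
    mulOverRight mu (((TensorProduct.assoc k H C N).symm.toLinearMap ∘ₗ
        f.lTensor H).lTensor (H ⊗[k] M) t) =
      (TensorProduct.assoc k H C (M ⊗[k] N)).symm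
        (((leftComm k M C N).toLinearMap ∘ₗ f.lTensor M).lTensor H
          (TensorProduct.map mu LinearMap.id (tensorTensorTensorComm k H M H N t))) := by
  have : mulOverRight mu ∘ₗ ((TensorProduct.assoc k H C N).symm.toLinearMap ∘ₗ
        f.lTensor H).lTensor (H ⊗[k] M) =
      (TensorProduct.assoc k H C (M ⊗[k] N)).symm.toLinearMap ∘ₗ
        ((leftComm k M C N).toLinearMap ∘ₗ f.lTensor M).lTensor H ∘ₗ
          TensorProduct.map mu LinearMap.id ∘ₗ
            (tensorTensorTensorComm k H M H N).toLinearMap := by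
    ext h m h' n
    simp only [TensorProduct.AlgebraTensorModule.curry_apply, LinearMap.restrictScalars_self,
      TensorProduct.curry_apply, comp_apply,
      lTensor_tmul, LinearEquiv.coe_coe, tensorTensorTensorComm_tmul,
      map_tmul, LinearMap.id_apply]
    induction f n <;> simp_all [mulOverRight, tmul_add]
  exact LinearMap.congr_fun this t

/-- Condition (E) places the `H`-legs of `t` in `(H ▢ H) ⊗ (M ⊗ N)`. -/
lemma rTensor_cotL_tensorTensorTensorComm (α β : H →ₗ[k] C) {t : (H ⊗[k] M) ⊗[k] (H ⊗[k] N)}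
    (ht : (LinearMap.rTensor (H ⊗[k] N)
        ((TensorProduct.assoc k H M C).symm.toLinearMap ∘ₗ
          LinearMap.lTensor H (TensorProduct.comm k C M).toLinearMap ∘ₗ
          (TensorProduct.assoc k H C M).toLinearMap ∘ₗ
          LinearMap.rTensor M (rhoL k H C β))) t =
      (TensorProduct.assoc k (H ⊗[k] M) C (H ⊗[k] N)).symm
        ((LinearMap.lTensor (H ⊗[k] M)
          ((TensorProduct.assoc k C H N).toLinearMap ∘ₗ
            LinearMap.rTensor N (lamL k H C α))) t)) :
    (cotL β).rTensor (M ⊗[k] N) (tensorTensorTensorComm k H M H N t) =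
      (cotR α).rTensor (M ⊗[k] N) (tensorTensorTensorComm k H M H N t) := by
  let S : ((H ⊗[k] M) ⊗[k] C) ⊗[k] (H ⊗[k] N) →ₗ[k] ((H ⊗[k] C) ⊗[k] H) ⊗[k] (M ⊗[k] N) :=
    (tensorTensorTensorComm k (H ⊗[k] C) M H N).toLinearMap ∘ₗ
      (rightComm k H M C).toLinearMap.rTensor (H ⊗[k] N)
  have eL : S ∘ₗ LinearMap.rTensor (H ⊗[k] N)
        ((TensorProduct.assoc k H M C).symm.toLinearMap ∘ₗ
          LinearMap.lTensor H (TensorProduct.comm k C M).toLinearMap ∘ₗ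
          (TensorProduct.assoc k H C M).toLinearMap ∘ₗ
          LinearMap.rTensor M (rhoL k H C β)) =
      (cotL β).rTensor (M ⊗[k] N) ∘ₗ (tensorTensorTensorComm k H M H N).toLinearMap := by
    ext h m h' n
    simp only [TensorProduct.AlgebraTensorModule.curry_apply, LinearMap.restrictScalars_self,
      TensorProduct.curry_apply, comp_apply, rTensor_tmul,
      LinearEquiv.coe_coe, tensorTensorTensorComm_tmul, cotL]
    induction rhoL k H C β h <;> simp_all [S, add_tmul]
  have eR : S ∘ₗ (TensorProduct.assoc k (H ⊗[k] M) C (H ⊗[k] N)).symm.toLinearMap ∘ₗ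
        LinearMap.lTensor (H ⊗[k] M)
          ((TensorProduct.assoc k C H N).toLinearMap ∘ₗ
            LinearMap.rTensor N (lamL k H C α)) =
      (cotR α).rTensor (M ⊗[k] N) ∘ₗ (tensorTensorTensorComm k H M H N).toLinearMap := by
    ext h m h' n
    simp only [TensorProduct.AlgebraTensorModule.curry_apply, LinearMap.restrictScalars_self,
      TensorProduct.curry_apply, comp_apply, rTensor_tmul,
      lTensor_tmul, LinearEquiv.coe_coe, tensorTensorTensorComm_tmul, cotR]
    induction lamL k H C α h' <;> simp_all [S, add_tmul, tmul_add]
  exact (LinearMap.congr_fun eL t).symm.trans ((congrArg S ht).trans (LinearMap.congr_fun eR t))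

end Reshuffle

end CotensorSlices

/- STATEMENT 6: well-definedness of the map
κ : (H ▢ M) ▢ (H ▢ N) → H ▢ (M ▢ N), (h ⊗ m) ⊗ (h' ⊗ n) ↦ hh' ⊗ (m ⊗ n). -/
theorem kappa_well_defined
    {M N : Type*} [AddCommGroup M] [Module k M] [AddCommGroup N] [Module k N]
    (B : LeftBicoalgebroid k H C)
    (bm : CBicomodule k C M) (bn : CBicomodule k C N)
    (t : (H ⊗[k] M) ⊗[k] (H ⊗[k] N))
    -- (A)  Σ h_(1) ⊗ α(h_(2)) ⊗ m ⊗ h' ⊗ n = Σ h ⊗ m_[-1] ⊗ m_[0] ⊗ h' ⊗ n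
    (hA : (LinearMap.rTensor (H ⊗[k] N)
        (LinearMap.rTensor M (TensorProduct.map LinearMap.id B.α ∘ₗ comul))) t =
      (LinearMap.rTensor (H ⊗[k] N)
        ((TensorProduct.assoc k H C M).symm.toLinearMap ∘ₗ LinearMap.lTensor H bm.lam)) t)
    -- (B)  Σ h_(1) ⊗ β(h_(2)) ⊗ m ⊗ h' ⊗ n = Σ h ⊗ m_[1] ⊗ m_[0] ⊗ h' ⊗ n
    (hB : (LinearMap.rTensor (H ⊗[k] N)
        (LinearMap.rTensor M (TensorProduct.map LinearMap.id B.β ∘ₗ comul))) t =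
      (LinearMap.rTensor (H ⊗[k] N)
        ((TensorProduct.assoc k H C M).symm.toLinearMap ∘ₗ
          LinearMap.lTensor H ((TensorProduct.comm k M C).toLinearMap ∘ₗ bm.rho))) t)
    -- (C)  Σ h ⊗ m ⊗ h'_(1) ⊗ α(h'_(2)) ⊗ n = Σ h ⊗ m ⊗ h' ⊗ n_[-1] ⊗ n_[0]
    (hC : (LinearMap.lTensor (H ⊗[k] M)
        (LinearMap.rTensor N (TensorProduct.map LinearMap.id B.α ∘ₗ comul))) t =
      (LinearMap.lTensor (H ⊗[k] M)
        ((TensorProduct.assoc k H C N).symm.toLinearMap ∘ₗ LinearMap.lTensor H bn.lam)) t)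
    -- (D)  Σ h ⊗ m ⊗ h'_(1) ⊗ β(h'_(2)) ⊗ n = Σ h ⊗ m ⊗ h' ⊗ n_[1] ⊗ n_[0]
    (hD : (LinearMap.lTensor (H ⊗[k] M)
        (LinearMap.rTensor N (TensorProduct.map LinearMap.id B.β ∘ₗ comul))) t =
      (LinearMap.lTensor (H ⊗[k] M)
        ((TensorProduct.assoc k H C N).symm.toLinearMap ∘ₗ
          LinearMap.lTensor H ((TensorProduct.comm k N C).toLinearMap ∘ₗ bn.rho))) t)
    -- (E)  Σ h_(2) ⊗ m ⊗ β(h_(1)) ⊗ h' ⊗ n = Σ h ⊗ m ⊗ α(h'_(1)) ⊗ h'_(2) ⊗ n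
    (hE : (LinearMap.rTensor (H ⊗[k] N)
        ((TensorProduct.assoc k H M C).symm.toLinearMap ∘ₗ
          LinearMap.lTensor H (TensorProduct.comm k C M).toLinearMap ∘ₗ
          (TensorProduct.assoc k H C M).toLinearMap ∘ₗ
          LinearMap.rTensor M (rhoL k H C B.β))) t =
      (TensorProduct.assoc k (H ⊗[k] M) C (H ⊗[k] N)).symm
        ((LinearMap.lTensor (H ⊗[k] M)
          ((TensorProduct.assoc k C H N).toLinearMap ∘ₗ
            LinearMap.rTensor N (lamL k H C B.α))) t)) :
    -- write μt = Σ hh' ⊗ (m ⊗ n)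
    ∀ μt : H ⊗[k] (M ⊗[k] N),
    μt = (TensorProduct.map B.mu LinearMap.id)
        ((tensorTensorTensorComm k H M H N) t) →
    -- (1)  Σ hh' ⊗ m_[0] ⊗ m_[1] ⊗ n = Σ hh' ⊗ m ⊗ n_[-1] ⊗ n_[0]
    ((LinearMap.lTensor H (LinearMap.rTensor N bm.rho)) μt =
      (LinearMap.lTensor H
        ((TensorProduct.assoc k M C N).symm.toLinearMap ∘ₗ
          LinearMap.lTensor M bn.lam)) μt) ∧
    -- (2)  Σ (hh')_(1) ⊗ α((hh')_(2)) ⊗ m ⊗ n = Σ hh' ⊗ m_[-1] ⊗ m_[0] ⊗ n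
    ((LinearMap.rTensor (M ⊗[k] N)
        (TensorProduct.map LinearMap.id B.α ∘ₗ comul)) μt =
      (TensorProduct.assoc k H C (M ⊗[k] N)).symm
        ((LinearMap.lTensor H
          ((TensorProduct.assoc k C M N).toLinearMap ∘ₗ
            LinearMap.rTensor N bm.lam)) μt)) ∧
    -- (3)  Σ (hh')_(1) ⊗ β((hh')_(2)) ⊗ m ⊗ n = Σ hh' ⊗ n_[1] ⊗ m ⊗ n_[0]
    ((LinearMap.rTensor (M ⊗[k] N)
        (TensorProduct.map LinearMap.id B.β ∘ₗ comul)) μt =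
      (TensorProduct.assoc k H C (M ⊗[k] N)).symm
        ((LinearMap.lTensor H
          ((TensorProduct.leftComm k M C N).toLinearMap ∘ₗ
            LinearMap.lTensor M ((TensorProduct.comm k N C).toLinearMap ∘ₗ bn.rho))) μt)) := by
  rintro _ rfl
  have hs := rTensor_cotL_tensorTensorTensorComm B.α B.β hE
  set s := tensorTensorTensorComm k H M H N t with hs_def
  have hα := congrArg (mulOverLeft B.mu) hA
  have hmβ := congrArg (mulOverLeft B.mu) hB
  have hnα := congrArg (mulOverRight B.mu) hC
  have hβ := congrArg (mulOverRight B.mu) hD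
  rw [mulOverLeft_rTensor, mulOverLeft_coaction, ← hs_def] at hα hmβ
  rw [mulOverRight_lTensor, mulOverRight_coaction, ← hs_def] at hnα hβ
  have h₁ := rTensor_apply_eq_of_eqOn_eqLocus (cotL B.β) (cotR B.α)
    (B.mu.rTensor C ∘ₗ (TensorProduct.rightComm k H C H).toLinearMap ∘ₗ
      (TensorProduct.map LinearMap.id B.β ∘ₗ comul (R := k)).rTensor H)
    (B.mu.rTensor C ∘ₗ (TensorProduct.assoc k H H C).symm.toLinearMap ∘ₗ
      (TensorProduct.map LinearMap.id B.α ∘ₗ comul (R := k)).lTensor H)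
    (fun _ hx => B.mu_beta_eq_mu_alpha hx) hs
  have h₂ := rTensor_apply_eq_of_eqOn_eqLocus (cotL B.β) (cotR B.α)
    ((TensorProduct.map LinearMap.id B.α ∘ₗ comul (R := k)) ∘ₗ B.mu)
    (B.mu.rTensor C ∘ₗ (TensorProduct.rightComm k H C H).toLinearMap ∘ₗ
      (TensorProduct.map LinearMap.id B.α ∘ₗ comul (R := k)).rTensor H)
    (fun _ hx => B.lTensor_alpha_comul_mu hx) hs
  have h₃ := rTensor_apply_eq_of_eqOn_eqLocus (cotL B.β) (cotR B.α)
    ((TensorProduct.map LinearMap.id B.β ∘ₗ comul (R := k)) ∘ₗ B.mu)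
    (B.mu.rTensor C ∘ₗ (TensorProduct.assoc k H H C).symm.toLinearMap ∘ₗ
      (TensorProduct.map LinearMap.id B.β ∘ₗ comul (R := k)).lTensor H)
    (fun _ hx => B.lTensor_beta_comul_mu hx) hs
  rw [LinearMap.rTensor_comp] at h₂ h₃
  refine ⟨?_, h₂.trans hα, h₃.trans hβ⟩
  have h := (TensorProduct.assoc k H C (M ⊗[k] N)).symm.injective (hmβ.symm.trans (h₁.trans hnα))
  let X : C ⊗[k] (M ⊗[k] N) →ₗ[k] (M ⊗[k] C) ⊗[k] N :=
    (TensorProduct.comm k C M).toLinearMap.rTensor N ∘ₗ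
      (TensorProduct.assoc k C M N).symm.toLinearMap
  have hm : bm.rho.rTensor N = X ∘ₗ (TensorProduct.assoc k C M N).toLinearMap ∘ₗ
      ((TensorProduct.comm k M C).toLinearMap ∘ₗ bm.rho).rTensor N := by
    ext m n
    simp [X]
  have hn : (TensorProduct.assoc k M C N).symm.toLinearMap ∘ₗ bn.lam.lTensor M =
      X ∘ₗ (TensorProduct.leftComm k M C N).toLinearMap ∘ₗ bn.lam.lTensor M := by
    ext m n
    simp only [TensorProduct.AlgebraTensorModule.curry_apply, LinearMap.restrictScalars_self,
      TensorProduct.curry_apply, LinearMap.comp_apply, LinearMap.lTensor_tmul,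
      LinearEquiv.coe_coe]
    induction bn.lam n <;> simp_all [X, TensorProduct.tmul_add]
  rw [hm, hn, LinearMap.lTensor_comp, LinearMap.lTensor_comp H X (_ ∘ₗ bn.lam.lTensor M),
    LinearMap.comp_apply, LinearMap.comp_apply]
  exact congrArg (X.lTensor H) h
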